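/- Let w be the unique infinite word beginning with a that is a fixed point of the substitution a ↦ aab, b ↦ aa (so w = aabaabaaaab…), and for n ≥ 1 let p_n be the position of the n-th occurrence of a in w and q_n the position of the n-th occurrence of b in w (positions 1-indexed). Then q_n = 2·p_n + n for all n ≥ 1. (These (p_n, q_n) are the P-positions of Fraenkel's (2,1)-Wythoff game.) -/

import Mathlib

inductive AB : Type | A | B
  deriving DecidableEq

/-- The substitution `a ↦ aab`, `b ↦ aa`. -/
def σ : AB → List AB
  | .A => [.A, .A, .B]
  | .B => [.A, .A]

/-- The `n`-th iterate `σⁿ(a)`. -/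
def σIter (n : ℕ) : List AB := (fun l => l.flatMap σ)^[n] [AB.A]

/-- The unique infinite word `w = aabaabaaaab⋯` (0-indexed) beginning with `a` that is
a fixed point of `σ`; since `σⁿ⁺¹(a)` has length greater than `n` and each `σⁿ(a)` is
a prefix of `σⁿ⁺¹(a)`, its `n`-th letter is the `n`-th letter of `σⁿ⁺¹(a)`. -/
def w (n : ℕ) : AB := (σIter (n + 1)).getD n AB.A

/-- The position (1-indexed) of the `n`-th occurrence (`n ≥ 1`) of the letter `x`
in the infinite word `w` (with letters at 0-indexed places). -/
noncomputable def occ (x : AB) (n : ℕ) : ℕ :=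
  Nat.nth (fun i => w i = x) (n - 1) + 1

theorem σIter_succ (n : ℕ) : σIter (n + 1) = (σIter n).flatMap σ :=
  Function.iterate_succ_apply' _ _ _

theorem List.IsPrefix.flatMap_σ {l l' : List AB} (h : l <+: l') :
    l.flatMap σ <+: l'.flatMap σ := by
  obtain ⟨t, rfl⟩ := h
  exact ⟨t.flatMap σ, by simp⟩

theorem σIter_prefix_succ (n : ℕ) : σIter n <+: σIter (n + 1) := by
  induction n with
  | zero => exact ⟨[.A, .B], rfl⟩
  | succ n ih =>
    rw [σIter_succ n, σIter_succ (n + 1)]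
    exact ih.flatMap_σ

theorem σIter_prefix_of_le {m n : ℕ} (h : m ≤ n) : σIter m <+: σIter n := by
  induction n, h using Nat.le_induction with
  | base => exact List.prefix_rfl
  | succ n _ ih => exact ih.trans (σIter_prefix_succ n)

theorem length_flatMap_σ (l : List AB) :
    (l.flatMap σ).length = 2 * l.length + l.count .A := by
  induction l with
  | nil => rfl
  | cons x l ih => cases x <;> simp [σ, ih] <;> ring

theorem count_B_flatMap_σ (l : List AB) : (l.flatMap σ).count .B = l.count .A := by
  induction l with
  | nil => rfl
  | cons x l ih => cases x <;> simp [σ, ih]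

theorem lt_length_σIter (n : ℕ) : n < (σIter n).length := by
  induction n with
  | zero => exact Nat.one_pos
  | succ n ih =>
    rw [σIter_succ, length_flatMap_σ]
    omega

theorem w_eq_getElem {i n : ℕ} (h : i < (σIter n).length) : w i = (σIter n)[i] := by
  have hi : i < (σIter (i + 1)).length := i.lt_succ_self.trans (lt_length_σIter _)
  rw [w, List.getD_eq_getElem _ _ hi]
  rcases le_total (i + 1) n with hn | hn
  · exact (σIter_prefix_of_le hn).getElem hi
  · exact ((σIter_prefix_of_le hn).getElem h).symm

/-- The prefix of `w` of length `m`. -/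
def wPrefix (m : ℕ) : List AB := (List.range m).map w

theorem length_wPrefix (m : ℕ) : (wPrefix m).length = m := by simp [wPrefix]

theorem wPrefix_succ (m : ℕ) : wPrefix (m + 1) = wPrefix m ++ [w m] := by
  simp [wPrefix, List.range_succ]

theorem eq_wPrefix_of_isPrefix_σIter {l : List AB} {n : ℕ} (h : l <+: σIter n) :
    l = wPrefix l.length := by
  refine List.ext_getElem (length_wPrefix _).symm fun i hi _ => ?_
  simp only [wPrefix, List.getElem_map, List.getElem_range]
  rw [w_eq_getElem (hi.trans_le h.length_le), h.getElem hi]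

theorem wPrefix_isPrefix_σIter (m : ℕ) : wPrefix m <+: σIter m := by
  have ht : (σIter m).take m <+: σIter m := ⟨_, List.take_append_drop m _⟩
  have h := eq_wPrefix_of_isPrefix_σIter ht
  rw [List.length_take_of_le (lt_length_σIter m).le] at h
  exact h ▸ ht

theorem flatMap_σ_wPrefix (m : ℕ) :
    (wPrefix m).flatMap σ = wPrefix ((wPrefix m).flatMap σ).length :=
  eq_wPrefix_of_isPrefix_σIter (n := m + 1) (σIter_succ m ▸ (wPrefix_isPrefix_σIter m).flatMap_σ)

theorem count_wPrefix (x : AB) (m : ℕ) :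
    (wPrefix m).count x = Nat.count (fun i => w i = x) m := by
  induction m with
  | zero => rfl
  | succ m ih => simp [wPrefix_succ, Nat.count_succ, ih, List.count_singleton]

theorem w_eq_of_wPrefix_eq_append {m : ℕ} {l t : List AB} {x : AB}
    (h : wPrefix m = l ++ x :: t) : w l.length = x := by
  have h' := congrArg (fun s => s[l.length]?) h
  have hm := congrArg List.length h
  simp only [length_wPrefix, List.length_append, List.length_cons] at hm
  simpa [wPrefix, List.getElem?_range (show l.length < m by omega)] using h'

theorem infinite_setOf_w_eq_A : {i | w i = AB.A}.Infinite := by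
  refine Set.infinite_of_forall_exists_gt fun m => ?_
  have h := flatMap_σ_wPrefix (m + 2)
  obtain ⟨t, ht⟩ : ∃ t, σ (w (m + 1)) = .A :: t := by cases w (m + 1) <;> exact ⟨_, rfl⟩
  have hs : (wPrefix (m + 2)).flatMap σ = (wPrefix (m + 1)).flatMap σ ++ .A :: t := by
    simp [wPrefix_succ (m + 1), ht]
  refine ⟨_, w_eq_of_wPrefix_eq_append (h.symm.trans hs), ?_⟩
  rw [length_flatMap_σ, length_wPrefix]
  omega

/-- The `n`-th `b` of `w` is the last letter of the image of the `n`-th `a`. -/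
theorem nth_B_eq (k : ℕ) :
    Nat.nth (fun i => w i = AB.B) k = 2 * Nat.nth (fun i => w i = AB.A) k + k + 2 := by
  set i := Nat.nth (fun i => w i = AB.A) k with hi
  have hA : w i = .A := Nat.nth_mem_of_infinite infinite_setOf_w_eq_A k
  have hk : (wPrefix i).count .A = k := by
    rw [count_wPrefix, hi, Nat.count_nth_of_infinite infinite_setOf_w_eq_A]
  have hs : (wPrefix (i + 1)).flatMap σ = ((wPrefix i).flatMap σ ++ [.A, .A]) ++ [.B] := by
    simp [wPrefix_succ, hA, σ]
  have hlen : ((wPrefix i).flatMap σ ++ [AB.A, .A]).length = 2 * i + k + 2 := by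
    simp [length_flatMap_σ, length_wPrefix, hk, -List.length_flatMap]
  have hw := (flatMap_σ_wPrefix (i + 1)).symm.trans hs
  have hB := w_eq_of_wPrefix_eq_append hw
  have hcount : Nat.count (fun i => w i = AB.B) (2 * i + k + 2) = k := by
    have h := congrArg (List.count AB.B) hw
    rw [hs, List.length_append, hlen, List.length_singleton, count_wPrefix,
      Nat.count_succ, List.count_append, List.count_append, count_B_flatMap_σ, hk] at h
    rw [hlen] at hB
    simpa [hB] using h
  rw [hlen] at hB
  have h := Nat.nth_count (p := fun i => w i = AB.B) hB
  rwa [hcount] at h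

/-- If `pₙ` is the position of the `n`-th `a` in `w` and `qₙ` the position of the
`n`-th `b` in `w`, then `qₙ = 2pₙ + n` for all `n ≥ 1`.  (These `(pₙ, qₙ)` are the
P-positions of Fraenkel's (2,1)-Wythoff game.) -/
theorem q_eq_two_p_add_n (n : ℕ) (hn : 1 ≤ n) :
    occ AB.B n = 2 * occ AB.A n + n := by
  rw [occ, occ, nth_B_eq]
  omega
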